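/- arXiv:2302.03067 — 5 statements merged into one kernel-verified Lean document; each statement's English description precedes it below -/
import Mathlib

section
/- Let 𝒳 be a finite nonempty alphabet, 𝓜 a countable nonempty class of probabilistic data generating sources with prior weights w₀^ρ > 0 summing to 1, and ξ the corresponding Bayesian mixture. Assume there exist μ₁, μ₂ ∈ 𝓜 and an infinite sequence a₁, a₂, … of symbols in 𝒳 such that |E_{x_{<t}∼μ₁}[μ₁(a_t | x_{<t})] − E_{x_{<t}∼μ₂}[μ₂(a_t | x_{<t})]| does not converge to 0 as t → ∞. Then there is no sequence Θ = (θ_t)_{t=1}^∞ of probability mass functions on 𝒳 such that the memoryless model ν_Θ satisfies E_{x_{<t}∼μ}[ |ν_{θ_t}(a_t) − ξ(a_t | x_{<t})| ] → 0 as t → ∞ for every μ ∈ 𝓜. -/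
open Filter Topology

/-- A probabilistic data generating source over a finite alphabet `𝒳`:
a compatible family of probability mass functions on strings. -/
structure Source (𝒳 : Type*) [Fintype 𝒳] where
  p : (n : ℕ) → (Fin n → 𝒳) → ℝ
  nonneg : ∀ n x, 0 ≤ p n x
  empty : ∀ x : Fin 0 → 𝒳, p 0 x = 1
  compat : ∀ n (x : Fin n → 𝒳), p n x = ∑ y : 𝒳, p (n + 1) (Fin.snoc x y)

/-- The marginal of the Bayesian mixture over the class `μ` with prior weights `w`. -/
noncomputable def mix {𝒳 : Type*} [Fintype 𝒳] {I : Type*}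
    (w : I → ℝ) (μ : I → Source 𝒳) (n : ℕ) (x : Fin n → 𝒳) : ℝ :=
  ∑' i, w i * (μ i).p n x

theorem Source.sum_snoc {𝒳 : Type*} [Fintype 𝒳] (n : ℕ) (f : (Fin (n+1) → 𝒳) → ℝ) :
    ∑ z, f z = ∑ x : Fin n → 𝒳, ∑ y : 𝒳, f (Fin.snoc x y) := by
  rw [← (Fin.snocEquiv (fun _ : Fin (n+1) => 𝒳)).sum_comp, Fintype.sum_prod_type, Finset.sum_comm]
  rfl

theorem Source.sum_one {𝒳 : Type*} [Fintype 𝒳] (P : Source 𝒳) (n : ℕ) :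
    ∑ x, P.p n x = 1 := by
  induction n with
  | zero => simp [P.empty]
  | succ n ih =>
    rw [Source.sum_snoc, ← ih]
    exact Finset.sum_congr rfl fun x _ => (P.compat n x).symm

theorem Source.le_one {𝒳 : Type*} [Fintype 𝒳] (P : Source 𝒳) (n : ℕ) (x : Fin n → 𝒳) :
    P.p n x ≤ 1 := by
  rw [← P.sum_one n]
  exact Finset.single_le_sum (fun z _ => P.nonneg n z) (Finset.mem_univ x)

theorem Source.snoc_le {𝒳 : Type*} [Fintype 𝒳] (P : Source 𝒳) (n : ℕ) (x : Fin n → 𝒳) (y : 𝒳) :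
    P.p (n+1) (Fin.snoc x y) ≤ P.p n x := by
  rw [P.compat n x]
  exact Finset.single_le_sum (f := fun y => P.p (n+1) (Fin.snoc x y))
    (fun z _ => P.nonneg _ _) (Finset.mem_univ y)

/-- Increment of the second moment of the likelihood ratio. -/
theorem Source.incr {𝒳 : Type*} [Fintype 𝒳] (P Q : Source 𝒳)
    (hz : ∀ n x, Q.p n x = 0 → P.p n x = 0) (n : ℕ) :
    ∑ x : Fin n → 𝒳, ∑ y : 𝒳, Q.p (n+1) (Fin.snoc x y) *
      (P.p (n+1) (Fin.snoc x y) / Q.p (n+1) (Fin.snoc x y) - P.p n x / Q.p n x) ^ 2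
    = (∑ x, P.p (n+1) x ^ 2 / Q.p (n+1) x) - ∑ x, P.p n x ^ 2 / Q.p n x := by
  rw [Source.sum_snoc, ← Finset.sum_sub_distrib]
  refine Finset.sum_congr rfl fun x _ => ?_
  have h1 : ∀ y, Q.p (n+1) (Fin.snoc x y) *
      (P.p (n+1) (Fin.snoc x y) / Q.p (n+1) (Fin.snoc x y) - P.p n x / Q.p n x) ^ 2
      = P.p (n+1) (Fin.snoc x y) ^ 2 / Q.p (n+1) (Fin.snoc x y)
        - P.p (n+1) (Fin.snoc x y) * (2 * (P.p n x / Q.p n x))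
        + Q.p (n+1) (Fin.snoc x y) * (P.p n x / Q.p n x) ^ 2 := by
    intro y
    by_cases h : Q.p (n+1) (Fin.snoc x y) = 0
    · simp [h, hz _ _ h]
    · generalize P.p n x / Q.p n x = r
      field_simp
      ring
  simp_rw [h1]
  rw [Finset.sum_add_distrib, Finset.sum_sub_distrib, ← Finset.sum_mul, ← Finset.sum_mul,
    ← P.compat, ← Q.compat]
  by_cases h : Q.p n x = 0
  · simp [h]
  · field_simp
    ring

theorem Source.merge {𝒳 : Type*} [Fintype 𝒳] (P Q : Source 𝒳) (c : ℝ) (hc : 0 < c)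
    (hPQ : ∀ n x, c * P.p n x ≤ Q.p n x) (a : ℕ → 𝒳) :
    Tendsto (fun t : ℕ => ∑ x : Fin t → 𝒳, |P.p (t+1) (Fin.snoc x (a t)) -
      P.p t x * (Q.p (t+1) (Fin.snoc x (a t)) / Q.p t x)|) atTop (𝓝 0) := by
  have hz : ∀ n x, Q.p n x = 0 → P.p n x = 0 := by
    intro n x h
    have h1 := hPQ n x
    have h2 := P.nonneg n x
    rw [h] at h1
    nlinarith
  set V : ℕ → ℝ := fun n => ∑ x, P.p n x ^ 2 / Q.p n x with hV
  have hmono : Monotone V := by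
    refine monotone_nat_of_le_succ fun n => ?_
    have := Source.incr P Q hz n
    have h0 : 0 ≤ V (n+1) - V n := by
      rw [hV]
      simp only
      rw [← this]
      exact Finset.sum_nonneg fun x _ => Finset.sum_nonneg fun y _ =>
        mul_nonneg (Q.nonneg _ _) (sq_nonneg _)
    linarith
  have hbdd : BddAbove (Set.range V) := by
    refine ⟨1 / c, ?_⟩
    rintro _ ⟨n, rfl⟩
    have : V n ≤ ∑ x, P.p n x * (1 / c) := by
      refine Finset.sum_le_sum fun x _ => ?_
      rcases (Q.nonneg n x).eq_or_lt with h | h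
      · simp [hz n x h.symm]
      · rw [div_le_iff₀ h]
        have h1 := mul_le_mul_of_nonneg_left (hPQ n x) (P.nonneg n x)
        have : P.p n x ^ 2 = (P.p n x * (c * P.p n x)) * (1/c) := by field_simp
        rw [this, mul_right_comm (P.p n x) (1 / c)]
        exact mul_le_mul_of_nonneg_right h1 (by positivity)
    rwa [← Finset.sum_mul, P.sum_one, one_mul] at this
  have hlim := tendsto_atTop_ciSup hmono hbdd
  have hd : Tendsto (fun n => V (n+1) - V n) atTop (𝓝 0) := by
    simpa using (hlim.comp (tendsto_add_atTop_nat 1)).sub hlim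
  have hs : Tendsto (fun n => √(V (n+1) - V n)) atTop (𝓝 0) := by
    simpa using hd.sqrt
  refine squeeze_zero (fun t => Finset.sum_nonneg fun x _ => abs_nonneg _) (fun t => ?_) hs
  apply Real.le_sqrt_of_sq_le
  set q : (Fin t → 𝒳) → ℝ := fun x => Q.p (t+1) (Fin.snoc x (a t)) with hq
  set d : (Fin t → 𝒳) → ℝ := fun x =>
    P.p (t+1) (Fin.snoc x (a t)) / Q.p (t+1) (Fin.snoc x (a t)) - P.p t x / Q.p t x with hdd
  have hq0 : ∀ x, 0 ≤ q x := fun x => Q.nonneg _ _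
  have hterm : ∀ x, |P.p (t+1) (Fin.snoc x (a t)) -
      P.p t x * (Q.p (t+1) (Fin.snoc x (a t)) / Q.p t x)| = √(q x) * (√(q x) * |d x|) := by
    intro x
    rw [← mul_assoc, Real.mul_self_sqrt (hq0 x)]
    nth_rw 1 [← abs_of_nonneg (hq0 x)]
    rw [← abs_mul]
    congr 1
    simp only [hq, hdd]
    by_cases h : Q.p (t+1) (Fin.snoc x (a t)) = 0
    · simp [h, hz _ _ h]
    · rw [mul_sub, mul_div_cancel₀ _ h]
      ring
  simp_rw [hterm]
  refine (Finset.sum_mul_sq_le_sq_mul_sq _ _ _).trans ?_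
  simp_rw [mul_pow, Real.sq_sqrt (hq0 _), sq_abs]
  have hA : ∑ x, q x ≤ 1 := by
    rw [← Q.sum_one t]
    exact Finset.sum_le_sum fun x _ => Q.snoc_le t x _
  have hB : ∑ x, q x * d x ^ 2 ≤ V (t+1) - V t := by
    rw [← Source.incr P Q hz t]
    refine Finset.sum_le_sum fun x _ => ?_
    exact Finset.single_le_sum (f := fun y => Q.p (t+1) (Fin.snoc x y) *
      (P.p (t+1) (Fin.snoc x y) / Q.p (t+1) (Fin.snoc x y) - P.p t x / Q.p t x) ^ 2)
      (fun y _ => mul_nonneg (Q.nonneg _ _) (sq_nonneg _)) (Finset.mem_univ (a t))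
  have hB0 : 0 ≤ ∑ x, q x * d x ^ 2 :=
    Finset.sum_nonneg fun x _ => mul_nonneg (hq0 x) (sq_nonneg _)
  nlinarith

theorem mix_summable {𝒳 : Type*} [Fintype 𝒳] {I : Type*} (w : I → ℝ) (hw : ∀ i, 0 < w i)
    (hw1 : ∑' i, w i = 1) (μ : I → Source 𝒳) (n : ℕ) (x : Fin n → 𝒳) :
    Summable (fun i => w i * (μ i).p n x) := by
  have hs : Summable w := by
    by_contra h
    rw [tsum_eq_zero_of_not_summable h] at hw1
    exact zero_ne_one hw1
  exact Summable.of_nonneg_of_le (fun i => mul_nonneg (hw i).le ((μ i).nonneg _ _))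
    (fun i => mul_le_of_le_one_right (hw i).le ((μ i).le_one _ _)) hs

/-- The mixture as a source. -/
noncomputable def mixSource {𝒳 : Type*} [Fintype 𝒳] {I : Type*} (w : I → ℝ) (hw : ∀ i, 0 < w i)
    (hw1 : ∑' i, w i = 1) (μ : I → Source 𝒳) : Source 𝒳 where
  p := mix w μ
  nonneg n x := tsum_nonneg fun i => mul_nonneg (hw i).le ((μ i).nonneg _ _)
  empty x := by simp [mix, (μ _).empty, hw1]
  compat n x := by
    unfold mix
    rw [← Summable.tsum_finsetSum fun y _ => mix_summable w hw hw1 μ _ _]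
    refine tsum_congr fun i => ?_
    rw [(μ i).compat, Finset.mul_sum]

/-- **Limitation of memoryless models** (Theorem 4.2): if two sources in the class have
expected conditional probabilities of the symbols `a t` whose difference does not vanish,
then no memoryless model `ν_Θ` (given by a sequence of pmfs `θ t` on `𝒳`) satisfies
`E_μ |ν_Θ(a_t|x_{<t}) - ξ(a_t|x_{<t})| → 0` for every `μ` in the class. -/
theorem stmt0 {𝒳 : Type*} [Fintype 𝒳] [Nonempty 𝒳]
    {I : Type*} [Countable I] [Nonempty I]
    (w : I → ℝ) (hw : ∀ i, 0 < w i) (hw1 : ∑' i, w i = 1)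
    (μ : I → Source 𝒳) (i₁ i₂ : I) (a : ℕ → 𝒳)
    (hdiv : ¬ Tendsto (fun t : ℕ =>
        |(∑ x : Fin t → 𝒳, (μ i₁).p t x *
            ((μ i₁).p (t + 1) (Fin.snoc x (a t)) / (μ i₁).p t x)) -
         (∑ x : Fin t → 𝒳, (μ i₂).p t x *
            ((μ i₂).p (t + 1) (Fin.snoc x (a t)) / (μ i₂).p t x))|)
      atTop (𝓝 0)) :
    ¬ ∃ θ : ℕ → 𝒳 → ℝ,
        (∀ t y, 0 ≤ θ t y) ∧ (∀ t, ∑ y : 𝒳, θ t y = 1) ∧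
        ∀ i : I, Tendsto (fun t : ℕ =>
            ∑ x : Fin t → 𝒳, (μ i).p t x *
              |θ t (a t) -
                mix w μ (t + 1) (Fin.snoc x (a t)) / mix w μ t x|)
          atTop (𝓝 0) := by
  rintro ⟨θ, -, -, h⟩
  apply hdiv
  have key : ∀ i, Tendsto (fun t : ℕ => (∑ x : Fin t → 𝒳, (μ i).p t x *
      ((μ i).p (t + 1) (Fin.snoc x (a t)) / (μ i).p t x)) - θ t (a t)) atTop (𝓝 0) := by
    intro i
    have hm := Source.merge (μ i) (mixSource w hw hw1 μ) (w i) (hw i)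
      (fun n x => (mix_summable w hw hw1 μ n x).le_tsum i
        (fun j _ => mul_nonneg (hw j).le ((μ j).nonneg _ _))) a
    have hsum := (h i).add hm
    rw [add_zero] at hsum
    refine squeeze_zero_norm (fun t => ?_) hsum
    rw [Real.norm_eq_abs]
    have e : (∑ x : Fin t → 𝒳, (μ i).p t x *
        ((μ i).p (t + 1) (Fin.snoc x (a t)) / (μ i).p t x)) - θ t (a t)
        = ∑ x : Fin t → 𝒳, ((μ i).p (t+1) (Fin.snoc x (a t)) - (μ i).p t x * θ t (a t)) := by
      rw [Finset.sum_sub_distrib, ← Finset.sum_mul, (μ i).sum_one, one_mul]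
      congr 1
      refine Finset.sum_congr rfl fun x _ => ?_
      by_cases hx : (μ i).p t x = 0
      · have h1 := (μ i).snoc_le t x (a t)
        have h2 := (μ i).nonneg (t+1) (Fin.snoc x (a t))
        rw [hx] at h1 ⊢
        rw [zero_mul]
        linarith
      · exact mul_div_cancel₀ _ hx
    rw [e, ← Finset.sum_add_distrib]
    refine (Finset.abs_sum_le_sum_abs _ _).trans (Finset.sum_le_sum fun x _ => ?_)
    change _ ≤ _ + |(μ i).p (t+1) (Fin.snoc x (a t)) -
      (μ i).p t x * (mix w μ (t+1) (Fin.snoc x (a t)) / mix w μ t x)|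
    generalize mix w μ (t+1) (Fin.snoc x (a t)) / mix w μ t x = r
    have e2 : (μ i).p t x * |θ t (a t) - r| = |(μ i).p t x * r - (μ i).p t x * θ t (a t)| := by
      rw [← mul_sub, abs_mul, abs_of_nonneg ((μ i).nonneg t x), abs_sub_comm]
    rw [e2]
    exact (abs_sub_le _ _ _).trans (add_comm _ _).le
  have := ((key i₁).sub (key i₂)).abs
  simpa using this
end

section
/- Let N_{d,1/2} be the depth-d PTW switch-count process with split probability 1/2. Then for all natural numbers k and d with d > k, the probability of exactly k switching-points equals P(N_{d,1/2} = k) = Catalan(k) · 2^{−(2k+1)}, where Catalan(k) = (2k)!/(k!·(k+1)!). In particular this value is the same for all d > k. -/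
/-- `ptwP p d k` is the probability `P(N_{d,p} = k)` that the depth-`d` PTW switch-count
process with split probability `p` produces exactly `k` switching-points: `N_{0,p}` is the
point mass at `0`, and `N_{d,p}` is, with probability `1-p`, the point mass at `0`, and
with probability `p`, the sum of two independent copies of `N_{d-1,p}` plus one. -/
noncomputable def ptwP (p : ℝ) : ℕ → ℕ → ℝ
  | 0, 0 => 1
  | 0, _ + 1 => 0
  | d + 1, k =>
      (1 - p) * (if k = 0 then 1 else 0) +
        p * ∑ j ∈ Finset.range k, ptwP p d j * ptwP p d (k - 1 - j)

/-- The `k`-th Catalan number `(2k)! / (k! (k+1)!)`, as a real number. -/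
noncomputable def cat (k : ℕ) : ℝ :=
  (Nat.factorial (2 * k) : ℝ) / ((Nat.factorial k : ℝ) * (Nat.factorial (k + 1) : ℝ))

theorem cat_eq_catalan (k : ℕ) : cat k = (catalan k : ℝ) := by
  have h := succ_mul_catalan_eq_centralBinom k
  have h2 : k.centralBinom * k.factorial * k.factorial = (2 * k).factorial := by
    have := Nat.choose_mul_factorial_mul_factorial (show k ≤ 2 * k by omega)
    rw [show 2 * k - k = k by omega] at this
    rw [Nat.centralBinom]
    exact this
  unfold cat
  rw [← h2, ← h, Nat.factorial_succ]
  have : (k.factorial : ℝ) ≠ 0 := by exact_mod_cast k.factorial_ne_zero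
  push_cast
  field_simp

theorem ptwP_catalan : ∀ d k : ℕ, k < d →
    ptwP (1/2) d k = (catalan k : ℝ) * (1 / 2 : ℝ) ^ (2 * k + 1) := by
  intro d
  induction d with
  | zero => intro k h; omega
  | succ d ih =>
    intro k h
    rw [ptwP]
    cases k with
    | zero => norm_num
    | succ n =>
      rw [catalan_succ, Fin.sum_univ_eq_sum_range (fun i => catalan i * catalan (n - i)) n.succ]
      push_cast
      rw [Finset.sum_mul, Finset.mul_sum]
      simp only [mul_zero, zero_add]
      refine Finset.sum_congr rfl fun j hj => ?_
      have hj := Finset.mem_range.1 hj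
      rw [ih j (by omega), ih (n - j) (by omega)]
      obtain ⟨m, rfl⟩ : ∃ m, n = j + m := ⟨n - j, by omega⟩
      rw [Nat.add_sub_cancel_left]
      ring

/-- **Limiting PTW switch-count probabilities** (split probability `1/2`): for all natural
numbers `k` and `d` with `d > k`, the probability of exactly `k` switching-points equals
`Catalan(k) * 2 ^ (-(2k+1))`; in particular this value is the same for all `d > k`. -/
theorem stmt6 :
    ∀ k d : ℕ, k < d →
      ptwP (1/2) d k = cat k * (2 : ℝ) ^ (-(2 * (k : ℤ) + 1)) := by
  intro k d h
  rw [ptwP_catalan d k h, cat_eq_catalan, zpow_neg, one_div, inv_pow]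
  norm_cast
end

section
/- Let N_{d,1/2} be the depth-d PTW switch-count process with split probability 1/2. Then for every d ∈ ℕ, the expected number of switching-points is E[N_{d,1/2}] = Σ_{k=0}^∞ k · P(N_{d,1/2} = k) = d/2. -/
/-- Probability generating polynomial of the switch-count process with `p = 1/2`. -/
noncomputable def ptwGen : ℕ → Polynomial ℝ
  | 0 => 1
  | d + 1 => Polynomial.C (1/2) + Polynomial.C (1/2) * (Polynomial.X * (ptwGen d * ptwGen d))

theorem ptwGen_coeff (d : ℕ) : ∀ k : ℕ, (ptwGen d).coeff k = ptwP (1/2) d k := by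
  induction d with
  | zero =>
    intro k
    cases k with
    | zero => simp [ptwGen, ptwP]
    | succ k => simp [ptwGen, ptwP, Polynomial.coeff_one]
  | succ d ih =>
    intro k
    cases k with
    | zero => simp [ptwGen, ptwP]; norm_num
    | succ k =>
      rw [ptwGen, ptwP, Polynomial.coeff_add, Polynomial.coeff_C_mul, Polynomial.coeff_X_mul,
        Polynomial.coeff_mul, Finset.Nat.sum_antidiagonal_eq_sum_range_succ_mk]
      simp [Polynomial.coeff_C, ih]

theorem ptwGen_eval (d : ℕ) : (ptwGen d).eval 1 = 1 := by
  induction d with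
  | zero => simp [ptwGen]
  | succ d ih => simp [ptwGen, ih]; norm_num

theorem ptwGen_deriv (d : ℕ) : (ptwGen d).derivative.eval 1 = (d : ℝ) / 2 := by
  induction d with
  | zero => simp [ptwGen]
  | succ d ih =>
    simp only [ptwGen, Polynomial.derivative_add, Polynomial.derivative_mul,
      Polynomial.derivative_C, Polynomial.derivative_X, Polynomial.eval_add, Polynomial.eval_mul,
      Polynomial.eval_C, Polynomial.eval_X, Polynomial.eval_zero, Polynomial.eval_one, ih,
      ptwGen_eval]
    push_cast
    ring

/-- **Expected number of PTW switching-points** (split probability `1/2`, Eq. (13)):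
for every depth `d`, `E[N_{d,1/2}] = ∑ₖ k * P(N_{d,1/2} = k) = d / 2`. -/
theorem stmt7 :
    ∀ d : ℕ, ∑' k : ℕ, (k : ℝ) * ptwP (1/2) d k = d / 2 := by
  intro d
  rw [← ptwGen_deriv d, Polynomial.derivative_eval, Polynomial.sum_def,
    tsum_eq_sum (s := (ptwGen d).support)]
  · refine Finset.sum_congr rfl fun k _ => ?_
    rw [ptwGen_coeff]
    simp [mul_comm]
  · intro k hk
    rw [← ptwGen_coeff, Polynomial.notMem_support_iff.mp hk, mul_zero]
end

section
/- Let N_{d,p} be the depth-d PTW switch-count process with split probability p ∈ (0,1), p ≠ 1/2. Then for every d ∈ ℕ, the expected number of switching-points is E[N_{d,p}] = p · (1 − (2p)^d)/(1 − 2p). Consequently, for p < 1/2 the expectation converges to p/(1−2p) as d → ∞, while for p > 1/2 it grows like (p/(2p−1))·(2p)^d. -/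
open Filter Topology

open Polynomial in
/-- Probability generating polynomial of the switch-count process. -/
noncomputable def ptwQ (p : ℝ) : ℕ → Polynomial ℝ
  | 0 => 1
  | d + 1 => C (1 - p) + C p * (X * (ptwQ p d * ptwQ p d))

open Polynomial in
theorem ptwQ_coeff (p : ℝ) (d : ℕ) : ∀ k, (ptwQ p d).coeff k = ptwP p d k := by
  induction d with
  | zero =>
    intro k
    cases k with
    | zero => simp [ptwQ, ptwP]
    | succ k => rw [ptwQ, ptwP, ← C_1, coeff_C_succ]
  | succ d ih =>
    intro k
    cases k with
    | zero => simp [ptwQ, ptwP]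
    | succ k =>
      rw [ptwQ, ptwP, coeff_add, coeff_C_mul, coeff_X_mul, coeff_mul,
        Finset.Nat.sum_antidiagonal_eq_sum_range_succ_mk]
      simp only [ih, coeff_C_succ]
      simp

open Polynomial in
theorem ptwQ_eval (p : ℝ) (d : ℕ) : (ptwQ p d).eval 1 = 1 := by
  induction d with
  | zero => simp [ptwQ]
  | succ d ih => simp [ptwQ, ih]

open Polynomial in
theorem ptw_mean (p : ℝ) (d : ℕ) :
    ∑' k : ℕ, (k : ℝ) * ptwP p d k = (derivative (ptwQ p d)).eval 1 := by
  rw [derivative_eval, Polynomial.sum, tsum_eq_sum (s := (ptwQ p d).support)]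
  · refine Finset.sum_congr rfl fun k _ => ?_
    rw [ptwQ_coeff]; simp [mul_comm]
  · intro k hk
    rw [← ptwQ_coeff, notMem_support_iff.mp hk, mul_zero]

open Polynomial in
theorem ptw_mean_eq (p : ℝ) (hp : p ≠ 1/2) (d : ℕ) :
    ∑' k : ℕ, (k : ℝ) * ptwP p d k = p * (1 - (2 * p) ^ d) / (1 - 2 * p) := by
  have h : 1 - 2 * p ≠ 0 := fun h => hp (by linarith)
  rw [ptw_mean]
  induction d with
  | zero => simp [ptwQ]
  | succ d ih =>
    have : (derivative (ptwQ p (d+1))).eval 1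
        = p * (1 + 2 * (derivative (ptwQ p d)).eval 1) := by
      simp only [ptwQ, derivative_add, derivative_mul, derivative_C, derivative_X, eval_add,
        eval_mul, eval_C, eval_X, eval_zero, eval_one, ptwQ_eval]
      ring
    rw [this, ih, eq_div_iff h, mul_assoc, add_mul, mul_assoc 2, div_mul_cancel₀ _ h]
    ring

/-- **Expected number of PTW switching-points for split probability `p ≠ 1/2`**:
`E[N_{d,p}] = p (1 - (2p)^d) / (1 - 2p)`; consequently the expectation converges to
`p/(1-2p)` as `d → ∞` when `p < 1/2`, and grows like `(p/(2p-1)) (2p)^d` when `p > 1/2`. -/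
theorem stmt8 (p : ℝ) (h0 : 0 < p) (h1 : p < 1) (hp : p ≠ 1/2) :
    (∀ d : ℕ, ∑' k : ℕ, (k : ℝ) * ptwP p d k = p * (1 - (2 * p) ^ d) / (1 - 2 * p)) ∧
    (p < 1/2 →
      Tendsto (fun d : ℕ => ∑' k : ℕ, (k : ℝ) * ptwP p d k) atTop
        (𝓝 (p / (1 - 2 * p)))) ∧
    (1/2 < p →
      Tendsto (fun d : ℕ => (∑' k : ℕ, (k : ℝ) * ptwP p d k) / (2 * p) ^ d) atTop
        (𝓝 (p / (2 * p - 1)))) := by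
  refine ⟨ptw_mean_eq p hp, fun h => ?_, fun h => ?_⟩
  · simp only [ptw_mean_eq p hp]
    have := tendsto_pow_atTop_nhds_zero_of_lt_one (r := 2 * p) (by linarith) (by linarith)
    simpa using ((this.const_sub 1).const_mul p).div_const (1 - 2 * p)
  · simp only [ptw_mean_eq p hp]
    have := tendsto_pow_atTop_nhds_zero_of_lt_one (r := (2 * p)⁻¹) (by positivity)
      (inv_lt_one_of_one_lt₀ (by linarith))
    have h2 := ((this.const_sub 1).const_mul p).div_const (2 * p - 1)
    rw [sub_zero, mul_one] at h2
    refine h2.congr fun d => ?_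
    have ha : 1 - 2 * p ≠ 0 := fun h => hp (by linarith)
    have hb : 2 * p - 1 ≠ 0 := fun h => hp (by linarith)
    have hc : (2 * p) ^ d ≠ 0 := by positivity
    rw [inv_pow]
    generalize (2 * p) ^ d = x at *
    rw [div_div, div_eq_div_iff hb (mul_ne_zero ha hc)]
    field_simp
    ring
end

section
/- Let N_{d,p} be the depth-d PTW switch-count process with split probability p ∈ (0,1). Then for all natural numbers k and d with d > k, the probability of exactly k switching-points equals P(N_{d,p} = k) = Catalan(k) · p^k · (1−p)^{k+1}, where Catalan(k) = (2k)!/(k!·(k+1)!). Equivalently, P(N_{d,p} = k) = Catalan(k)·2^{−(2k+1)} · 2(1−p) · (4p(1−p))^k. -/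
theorem ptw_main (p : ℝ) (d : ℕ) : ∀ k : ℕ, k < d →
    ptwP p d k = (catalan k : ℝ) * p ^ k * (1 - p) ^ (k + 1) := by
  induction d with
  | zero => intro k hk; omega
  | succ d ih =>
    intro k hk
    rw [ptwP]
    cases k with
    | zero => simp
    | succ k =>
      rw [catalan_succ', Finset.Nat.sum_antidiagonal_eq_sum_range_succ_mk]
      push_cast
      simp only [Nat.succ_ne_zero, if_false, mul_zero, zero_add, Finset.sum_mul, Finset.mul_sum]
      refine Finset.sum_congr rfl fun j hj => ?_
      have hj' := Finset.mem_range.mp hj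
      rw [ih j (by omega), ih (k - j) (by omega)]
      obtain ⟨m, rfl⟩ : ∃ m, k = j + m := ⟨k - j, by omega⟩
      rw [show j + m - j = m by omega]
      ring

/-- **Limiting PTW switch-count probabilities for general split probability `p`**: for all
`d > k`, `P(N_{d,p} = k) = Catalan(k) p^k (1-p)^{k+1}`, which can equivalently be written
as `Catalan(k) 2^{-(2k+1)} * 2(1-p) * (4p(1-p))^k`. -/
theorem stmt9 (p : ℝ) (h0 : 0 < p) (h1 : p < 1) :
    ∀ k d : ℕ, k < d →
      ptwP p d k = cat k * p ^ k * (1 - p) ^ (k + 1) ∧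
      ptwP p d k =
        cat k * (2 : ℝ) ^ (-(2 * (k : ℤ) + 1)) * (2 * (1 - p)) *
          (4 * p * (1 - p)) ^ k := by
  intro k d hkd
  have h := ptw_main p d k hkd
  rw [← cat_eq_catalan] at h
  refine ⟨h, ?_⟩
  rw [h]
  have e : (2 : ℝ) ^ (-(2 * (k : ℤ) + 1)) = (4 ^ k * 2)⁻¹ := by
    rw [zpow_neg]
    congr 1
    rw [zpow_add₀ (by norm_num), zpow_mul]
    norm_num
  rw [e, mul_pow, mul_pow]
  have : (4 : ℝ) ^ k ≠ 0 := by positivity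
  field_simp
  ring
end
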